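/- arXiv:1209.3960 — 7 statements merged into one kernel-verified Lean document; each statement's English description precedes it below -/
import Mathlib

section
/- Let A be a ring, let ι : P → Q and κ : R → S be injective homomorphisms of (left) A-modules with S projective, and let π : Q → Q/ι(P) and σ : S → S/κ(R) denote the quotient maps. Let Y be the abelian group of pairs (α, β) with α ∈ Hom_A(R, P), β ∈ Hom_A(S, Q) and ι ∘ α = β ∘ κ. For each (α, β) ∈ Y there is a unique homomorphism β̄ : S/κ(R) → Q/ι(P) with β̄ ∘ σ = π ∘ β. Then the sequence 0 → Hom_A(S, P) → Y → Hom_A(S/κ(R), Q/ι(P)) → 0 is exact, where the first map sends g to the pair (g ∘ κ, ι ∘ g) and the second map sends (α, β) to β̄: that is, the first map is injective, the second map is surjective, and the image of the first equals the kernel of the second. -/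
/-- A linear map whose values lie in the range of an injective linear map factors through it. -/
theorem LinearMap.exists_comp_eq_of_forall_mem_range {A M P Q : Type*} [Ring A]
    [AddCommGroup M] [AddCommGroup P] [AddCommGroup Q] [Module A M] [Module A P] [Module A Q]
    {ι : P →ₗ[A] Q} (hι : Function.Injective ι) (f : M →ₗ[A] Q)
    (hf : ∀ x, f x ∈ LinearMap.range ι) : ∃ g : M →ₗ[A] P, ι ∘ₗ g = f := by
  refine ⟨(LinearEquiv.ofInjective ι hι).symm ∘ₗ f.codRestrict _ hf, LinearMap.ext fun x => ?_⟩
  exact congrArg Subtype.val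
    ((LinearEquiv.ofInjective ι hι).apply_symm_apply (f.codRestrict _ hf x))


/-- Let `ι : P → Q` and `κ : R → S` be injective `A`-module maps with `S`
projective, and let `π`, `σ` be the quotient maps onto `Q/ι(P)` and `S/κ(R)`. Let `Y` be
the set of pairs `(α, β)` with `ι ∘ α = β ∘ κ`. Each `(α, β) ∈ Y` induces a unique
`β̄ : S/κ(R) → Q/ι(P)` with `β̄ ∘ σ = π ∘ β`, and the sequence
`0 → Hom(S, P) → Y → Hom(S/κ(R), Q/ι(P)) → 0`, with first map `g ↦ (g ∘ κ, ι ∘ g)` and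
second map `(α, β) ↦ β̄`, is exact. -/
theorem exact_sequence_of_embedding_hom
    {A : Type*} [Ring A] {P Q R S : Type*}
    [AddCommGroup P] [AddCommGroup Q] [AddCommGroup R] [AddCommGroup S]
    [Module A P] [Module A Q] [Module A R] [Module A S]
    (ι : P →ₗ[A] Q) (κ : R →ₗ[A] S)
    (hι : Function.Injective ι) (hκ : Function.Injective κ)
    (hS : Module.Projective A S) :
    (∀ y : {p : (R →ₗ[A] P) × (S →ₗ[A] Q) // ι ∘ₗ p.1 = p.2 ∘ₗ κ},
       ∃! b : (S ⧸ LinearMap.range κ) →ₗ[A] (Q ⧸ LinearMap.range ι),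
         b ∘ₗ (LinearMap.range κ).mkQ = (LinearMap.range ι).mkQ ∘ₗ y.1.2) ∧
    (∀ Φ : {p : (R →ₗ[A] P) × (S →ₗ[A] Q) // ι ∘ₗ p.1 = p.2 ∘ₗ κ} →
        ((S ⧸ LinearMap.range κ) →ₗ[A] (Q ⧸ LinearMap.range ι)),
      (∀ y, (Φ y) ∘ₗ (LinearMap.range κ).mkQ = (LinearMap.range ι).mkQ ∘ₗ y.1.2) →
        (Function.Injective fun g : S →ₗ[A] P =>
          (⟨(g ∘ₗ κ, ι ∘ₗ g), rfl⟩ :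
            {p : (R →ₗ[A] P) × (S →ₗ[A] Q) // ι ∘ₗ p.1 = p.2 ∘ₗ κ})) ∧
        Function.Surjective Φ ∧
        ∀ y, Φ y = 0 ↔ ∃ g : S →ₗ[A] P, y.1 = (g ∘ₗ κ, ι ∘ₗ g)) := by
  have cancel_mkQ : ∀ {b c : (S ⧸ LinearMap.range κ) →ₗ[A] (Q ⧸ LinearMap.range ι)},
      b ∘ₗ (LinearMap.range κ).mkQ = c ∘ₗ (LinearMap.range κ).mkQ → b = c :=
    fun h => Submodule.linearMap_qext _ h
  refine ⟨?_, fun Φ hΦ => ⟨?_, ?_, ?_⟩⟩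
  · rintro ⟨⟨α, β⟩, h⟩
    have hker : LinearMap.range κ ≤ LinearMap.ker ((LinearMap.range ι).mkQ ∘ₗ β) := by
      rintro _ ⟨r, rfl⟩
      exact (Submodule.Quotient.mk_eq_zero _).2 ⟨α r, LinearMap.congr_fun h r⟩
    exact ⟨(LinearMap.range κ).liftQ _ hker, Submodule.liftQ_mkQ _ _ hker,
      fun c hc => cancel_mkQ (hc.trans (Submodule.liftQ_mkQ _ _ hker).symm)⟩
  · intro g g' h
    have h2 : ι ∘ₗ g = ι ∘ₗ g' := congrArg (fun y => y.1.2) h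
    exact LinearMap.ext fun s => hι (LinearMap.congr_fun h2 s)
  · intro b
    obtain ⟨β, hβ⟩ := Module.projective_lifting_property (LinearMap.range ι).mkQ
      (b ∘ₗ (LinearMap.range κ).mkQ) (Submodule.mkQ_surjective _)
    obtain ⟨α, hα⟩ := LinearMap.exists_comp_eq_of_forall_mem_range hι (β ∘ₗ κ) fun r => by
      refine (Submodule.Quotient.mk_eq_zero _).1 ((LinearMap.congr_fun hβ (κ r)).trans ?_)
      have hr : (LinearMap.range κ).mkQ (κ r) = 0 :=
        (Submodule.Quotient.mk_eq_zero _).2 ⟨r, rfl⟩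
      rw [LinearMap.comp_apply, hr, map_zero]
    exact ⟨⟨(α, β), hα⟩, cancel_mkQ ((hΦ _).trans hβ)⟩
  · rintro ⟨⟨α, β⟩, h⟩
    have hy := hΦ ⟨(α, β), h⟩
    constructor
    · intro h0
      rw [h0, LinearMap.zero_comp] at hy
      obtain ⟨g, rfl⟩ := LinearMap.exists_comp_eq_of_forall_mem_range hι β fun s =>
        (Submodule.Quotient.mk_eq_zero _).1 (LinearMap.congr_fun hy s).symm
      exact ⟨g, Prod.ext (LinearMap.ext fun r => hι (LinearMap.congr_fun h r)) rfl⟩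
    · rintro ⟨g, hg⟩
      obtain ⟨rfl, rfl⟩ := Prod.mk.inj hg
      refine cancel_mkQ (hy.trans (LinearMap.ext fun s => ?_))
      exact (Submodule.Quotient.mk_eq_zero _).2 ⟨g s, rfl⟩
end

section
/- Let A be a ring, let ι : P → Q be an injective homomorphism of (left) A-modules with quotient map π : Q → M where M = Q/ι(P), and let κ : R → S be an injective homomorphism of A-modules with S projective. Consider the map Θ : Hom_A(S, Q) → Hom_A(R, M) defined by Θ(β) = π ∘ β ∘ κ. Then: (a) the image of Θ equals the set { f ∘ κ : f ∈ Hom_A(S, M) }, i.e., the image of the restriction map Hom_A(S, M) → Hom_A(R, M); (b) the kernel of Θ equals the set of β ∈ Hom_A(S, Q) for which there exists α : R → P with ι ∘ α = β ∘ κ, and for each such β this α is unique. -/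
/-- Let `ι : P → Q` be an injective `A`-module map with quotient map
`π : Q → M := Q/ι(P)`, and `κ : R → S` an injective map with `S` projective. For
`Θ : Hom(S, Q) → Hom(R, M)`, `Θ(β) = π ∘ β ∘ κ`: (a) the image of `Θ` is the image of the
restriction map `Hom(S, M) → Hom(R, M)`; (b) `Θ(β) = 0` iff there is a (then unique)
`α : R → P` with `ι ∘ α = β ∘ κ`. -/
theorem range_and_kernel_of_theta
    {A : Type*} [Ring A] {P Q R S : Type*}
    [AddCommGroup P] [AddCommGroup Q] [AddCommGroup R] [AddCommGroup S]
    [Module A P] [Module A Q] [Module A R] [Module A S]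
    (ι : P →ₗ[A] Q) (κ : R →ₗ[A] S)
    (hι : Function.Injective ι) (hκ : Function.Injective κ)
    (hS : Module.Projective A S) :
    (Set.range (fun β : S →ₗ[A] Q => (LinearMap.range ι).mkQ ∘ₗ β ∘ₗ κ) =
      {g : R →ₗ[A] Q ⧸ LinearMap.range ι |
        ∃ f : S →ₗ[A] Q ⧸ LinearMap.range ι, g = f ∘ₗ κ}) ∧
    (∀ β : S →ₗ[A] Q,
      (LinearMap.range ι).mkQ ∘ₗ β ∘ₗ κ = 0 ↔ ∃! α : R →ₗ[A] P, ι ∘ₗ α = β ∘ₗ κ) := by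
  constructor
  · ext g
    constructor
    · rintro ⟨β, rfl⟩
      exact ⟨(LinearMap.range ι).mkQ ∘ₗ β, rfl⟩
    · rintro ⟨f, rfl⟩
      obtain ⟨β, rfl⟩ := Module.projective_lifting_property (LinearMap.range ι).mkQ f
        (Submodule.mkQ_surjective _)
      exact ⟨β, rfl⟩
  · intro β
    constructor
    · intro h
      have hmem (r : R) : (β ∘ₗ κ) r ∈ LinearMap.range ι := by
        simpa using LinearMap.congr_fun h r
      have hcomp : ι ∘ₗ ((LinearEquiv.ofInjective ι hι).symm.toLinearMap ∘ₗ
          (β ∘ₗ κ).codRestrict (LinearMap.range ι) hmem) = β ∘ₗ κ := by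
        ext r
        exact congrArg Subtype.val ((LinearEquiv.ofInjective ι hι).apply_symm_apply
          ((β ∘ₗ κ).codRestrict (LinearMap.range ι) hmem r))
      exact ⟨_, hcomp, fun α hα => LinearMap.cancel_left hι |>.mp (hα.trans hcomp.symm)⟩
    · rintro ⟨α, hα, -⟩
      rw [← hα, ← LinearMap.comp_assoc, LinearMap.range_mkQ_comp, LinearMap.zero_comp]
end

section
/- Let A be a ring and consider Ext groups in the category of (left) A-modules. Let M be an A-module such that: Ext^3_A(X, Y) = 0 for all A-modules X and Y; Ext^2_A(M, X) = 0 for all A-modules X; Ext^2_A(X, M) = 0 for all A-modules X; and Ext^1_A(M, M) = 0. Then for every submodule N of M, one has Ext^1_A(N, M/N) = 0 and Ext^2_A(N, M/N) = 0. -/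
open CategoryTheory

universe u

namespace CategoryTheory.ShortComplex.ShortExact

variable {C : Type*} [Category* C] [Abelian C] [HasExt C] {S : ShortComplex C}

lemma subsingleton_ext_X₁ (hS : S.ShortExact) (Y : C) {n₀ n₁ : ℕ} (h : 1 + n₀ = n₁)
    (h₂ : Subsingleton (Abelian.Ext S.X₂ Y n₀)) (h₃ : Subsingleton (Abelian.Ext S.X₃ Y n₁)) :
    Subsingleton (Abelian.Ext S.X₁ Y n₀) := by
  refine subsingleton_of_forall_eq 0 fun x => ?_
  obtain ⟨y, rfl⟩ := Abelian.Ext.contravariant_sequence_exact₁ hS Y x h (Subsingleton.elim _ _)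
  rw [Subsingleton.elim y 0, Abelian.Ext.comp_zero]

lemma subsingleton_ext_X₃ (hS : S.ShortExact) (X : C) {n₀ n₁ : ℕ} (h : n₀ + 1 = n₁)
    (h₂ : Subsingleton (Abelian.Ext X S.X₂ n₀)) (h₁ : Subsingleton (Abelian.Ext X S.X₁ n₁)) :
    Subsingleton (Abelian.Ext X S.X₃ n₀) := by
  refine subsingleton_of_forall_eq 0 fun x => ?_
  obtain ⟨y, rfl⟩ := Abelian.Ext.covariant_sequence_exact₃ X hS x h (Subsingleton.elim _ _)
  rw [Subsingleton.elim y 0, Abelian.Ext.zero_comp]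

end CategoryTheory.ShortComplex.ShortExact

/-- Let `A` be a ring and `M` an `A`-module such that `Ext³(X, Y) = 0`
for all `A`-modules `X, Y` (global dimension at most two), `Ext²(M, X) = 0` for all `X`
(projective dimension at most one), `Ext²(X, M) = 0` for all `X` (injective dimension at
most one), and `Ext¹(M, M) = 0`. Then for every submodule `N ⊆ M` one has
`Ext¹(N, M/N) = 0` and `Ext²(N, M/N) = 0`. -/
theorem ext_vanishing_for_subrepresentations
    {A : Type u} [Ring A] [HasExt.{u} (ModuleCat.{u} A)]
    (M : ModuleCat.{u} A)
    (h3 : ∀ X Y : ModuleCat.{u} A, Subsingleton (Abelian.Ext X Y 3))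
    (hpd : ∀ X : ModuleCat.{u} A, Subsingleton (Abelian.Ext M X 2))
    (hid : ∀ X : ModuleCat.{u} A, Subsingleton (Abelian.Ext X M 2))
    (hrigid : Subsingleton (Abelian.Ext M M 1))
    (N : Submodule A M) :
    Subsingleton (Abelian.Ext (ModuleCat.of A N) (ModuleCat.of A (M ⧸ N)) 1) ∧
    Subsingleton (Abelian.Ext (ModuleCat.of A N) (ModuleCat.of A (M ⧸ N)) 2) := by
  have hS : (ModuleCat.shortComplexOfCompEqZero N.subtype N.mkQ
      (by ext x; simp)).ShortExact :=
    ModuleCat.shortComplex_shortExact _ (LinearMap.exact_subtype_mkQ N) N.injective_subtype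
      N.mkQ_surjective
  have hN₂ (X : ModuleCat.{u} A) : Subsingleton (Abelian.Ext (ModuleCat.of A N) X 2) :=
    hS.subsingleton_ext_X₁ X rfl (hpd X) (h3 _ X)
  have hNM : Subsingleton (Abelian.Ext (ModuleCat.of A N) M 1) :=
    hS.subsingleton_ext_X₁ M rfl hrigid (hid _)
  exact ⟨hS.subsingleton_ext_X₃ _ rfl hNM (hN₂ _), hN₂ _⟩
end

section
/- Let k be a field, let V and W be finite-dimensional k-vector spaces with dim V = d₁ and dim W = d₂, and let f : V → W be a k-linear map of rank r. Let e₁ ≤ d₁ and e₂ ≤ d₂ be natural numbers. Then there exist subspaces U₁ ⊆ V and U₂ ⊆ W with dim U₁ = e₁, dim U₂ = e₂ and f(U₁) ⊆ U₂ if and only if r ≤ d₁ − e₁ + e₂. -/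
open Module

/-- Between nested finite-dimensional subspaces there are subspaces of every intermediate
dimension. -/
theorem Submodule.exists_between_finrank_eq {k V : Type*} [DivisionRing k] [AddCommGroup V]
    [Module k V] [FiniteDimensional k V] {A B : Submodule k V} (hAB : A ≤ B) {n : ℕ}
    (hA : finrank k A ≤ n) (hB : n ≤ finrank k B) :
    ∃ U : Submodule k V, A ≤ U ∧ U ≤ B ∧ finrank k U = n := by
  induction n, hA using Nat.le_induction with
  | base => exact ⟨A, le_rfl, hAB, rfl⟩
  | succ n _ ih =>
    obtain ⟨U, hAU, hUB, rfl⟩ := ih (by lia)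
    obtain ⟨x, hxB, hxU⟩ : ∃ x ∈ B, x ∉ U := by
      by_contra! h
      have := Submodule.finrank_mono (R := k) (show B ≤ U from h)
      lia
    refine ⟨U ⊔ Submodule.span k {x}, hAU.trans le_sup_left,
      sup_le hUB ((Submodule.span_singleton_le_iff_mem _ _).2 hxB), ?_⟩
    exact Submodule.finrank_sup_span_singleton hxU

/-- The rank-nullity theorem for the restriction of a linear map to a subspace. -/
theorem LinearMap.finrank_map_add_finrank_ker_inf {k V W : Type*} [DivisionRing k]
    [AddCommGroup V] [Module k V] [AddCommGroup W] [Module k W] [FiniteDimensional k V]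
    (f : V →ₗ[k] W) (U : Submodule k V) :
    finrank k (U.map f) + finrank k (U ⊓ LinearMap.ker f : Submodule k V) =
      finrank k U := by
  rw [← LinearMap.finrank_range_add_finrank_ker (f.domRestrict U), LinearMap.range_domRestrict,
    LinearMap.ker_domRestrict, ← Submodule.map_comap_subtype,
    Submodule.finrank_map_subtype_eq]

/-- For a linear map `f : V → W` of rank `r` between spaces of dimensions
`d₁` and `d₂`, and `e₁ ≤ d₁`, `e₂ ≤ d₂`, there exist subspaces `U₁ ⊆ V`, `U₂ ⊆ W` with
`dim U₁ = e₁`, `dim U₂ = e₂` and `f(U₁) ⊆ U₂` if and only if `r ≤ d₁ - e₁ + e₂`. -/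
theorem quiverGrassmannian_A2_nonempty_iff
    {k V W : Type*} [Field k]
    [AddCommGroup V] [Module k V] [AddCommGroup W] [Module k W]
    [FiniteDimensional k V] [FiniteDimensional k W]
    {d₁ d₂ e₁ e₂ r : ℕ}
    (hd₁ : finrank k V = d₁) (hd₂ : finrank k W = d₂)
    (f : V →ₗ[k] W) (hr : finrank k (LinearMap.range f) = r)
    (he₁ : e₁ ≤ d₁) (he₂ : e₂ ≤ d₂) :
    (∃ (U₁ : Submodule k V) (U₂ : Submodule k W),
      finrank k U₁ = e₁ ∧ finrank k U₂ = e₂ ∧ U₁.map f ≤ U₂) ↔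
    r ≤ d₁ - e₁ + e₂ := by
  have hrank := f.finrank_range_add_finrank_ker
  constructor
  · rintro ⟨U₁, U₂, h₁, h₂, hU⟩
    have hmap := f.finrank_map_add_finrank_ker_inf U₁
    have hker : finrank k (U₁ ⊓ LinearMap.ker f : Submodule k V) ≤ finrank k (LinearMap.ker f) :=
      Submodule.finrank_mono inf_le_right
    have hle := Submodule.finrank_mono hU
    lia
  · intro h
    obtain ⟨U₁, h₁, hU₁⟩ : ∃ U₁ : Submodule k V, finrank k U₁ = e₁ ∧
        finrank k (U₁.map f) ≤ e₂ := by
      rcases le_total e₁ (finrank k (LinearMap.ker f)) with hle | hle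
      · obtain ⟨U, -, hU, hU'⟩ := Submodule.exists_between_finrank_eq
          (bot_le (a := LinearMap.ker f)) (by simp) hle
        refine ⟨U, hU', ?_⟩
        have hmap := f.finrank_map_add_finrank_ker_inf U
        rw [inf_eq_left.2 hU] at hmap
        lia
      · obtain ⟨U, hU, -, hU'⟩ := Submodule.exists_between_finrank_eq
          (le_top (a := LinearMap.ker f)) hle (by rwa [finrank_top, hd₁])
        refine ⟨U, hU', ?_⟩
        have hmap := f.finrank_map_add_finrank_ker_inf U
        rw [inf_eq_right.2 hU] at hmap
        lia
    obtain ⟨U₂, hU, -, h₂⟩ := Submodule.exists_between_finrank_eq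
      (le_top (a := U₁.map f)) hU₁ (by rwa [finrank_top, hd₂])
    exact ⟨U₁, U₂, h₁, h₂, hU⟩
end

section
/- Let k be a field, let V and W be finite-dimensional k-vector spaces with dim V = d₁ and dim W = d₂, and let f : V → W be a k-linear map of rank r. Let e₁ ≤ d₁, e₂ ≤ d₂, r′ and r″ be natural numbers. Then there exist subspaces U₁ ⊆ V and U₂ ⊆ W with dim U₁ = e₁, dim U₂ = e₂, f(U₁) ⊆ U₂, such that the restriction f|_{U₁} : U₁ → U₂ has rank r′ and the induced map f̄ : V/U₁ → W/U₂ has rank r″, if and only if the following inequalities hold: max(0, r + e₁ − d₁) ≤ r′ ≤ e₁, max(0, r − e₂) ≤ r″ ≤ d₂ − e₂, and r′ + r″ ≤ r. -/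
open Module

namespace Submodule

variable {k V W : Type*} [Field k] [AddCommGroup V] [Module k V] [AddCommGroup W] [Module k W]

/-- Rank-nullity for the restriction of a linear map to a subspace. -/
theorem finrank_map_add_finrank_ker_inf [FiniteDimensional k V] (g : V →ₗ[k] W)
    (p : Submodule k V) :
    finrank k (p.map g) + finrank k ↥(LinearMap.ker g ⊓ p) = finrank k p := by
  have h := (g.domRestrict p).finrank_range_add_finrank_ker
  rw [LinearMap.range_domRestrict, LinearMap.ker_domRestrict] at h
  rw [← h, ← finrank_map_subtype_eq p (comap _ _), map_comap_subtype, inf_comm]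

/-- A subspace contains subspaces of every smaller dimension. -/
theorem exists_le_finrank_eq (p : Submodule k V) {n : ℕ} (hn : n ≤ finrank k p) :
    ∃ q ≤ p, finrank k q = n := by
  obtain ⟨v, hv⟩ := exists_linearIndependent_of_le_finrank hn
  refine ⟨(span k (Set.range v)).map p.subtype, map_subtype_le _ _, ?_⟩
  rw [finrank_map_subtype_eq, finrank_span_eq_card hv, Fintype.card_fin]

theorem finrank_sup_of_disjoint [FiniteDimensional k V] {p q : Submodule k V}
    (h : Disjoint p q) : finrank k ↥(p ⊔ q) = finrank k p + finrank k q := by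
  have := finrank_sup_add_finrank_inf_eq p q
  rwa [h.eq_bot, finrank_bot, add_zero] at this

/-- Between nested subspaces there are subspaces of every intermediate dimension. -/
theorem exists_between_finrank_eq_s14 [FiniteDimensional k V] {p q : Submodule k V} (hpq : p ≤ q)
    {n : ℕ} (hp : finrank k p ≤ n) (hq : n ≤ finrank k q) :
    ∃ s, p ≤ s ∧ s ≤ q ∧ finrank k s = n := by
  obtain ⟨c, hc⟩ := p.exists_isCompl
  have hd : Disjoint p (c ⊓ q) := hc.disjoint.mono_right inf_le_left
  have hsup : p ⊔ c ⊓ q = q := by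
    rw [← sup_inf_assoc_of_le c hpq, hc.sup_eq_top, top_inf_eq]
  have hdim := finrank_sup_of_disjoint hd
  rw [hsup] at hdim
  obtain ⟨t, ht, htn⟩ := (c ⊓ q).exists_le_finrank_eq (n := n - finrank k p) (by omega)
  refine ⟨p ⊔ t, le_sup_left, sup_le hpq (ht.trans inf_le_right), ?_⟩
  rw [finrank_sup_of_disjoint (hd.mono_right ht)]
  omega

/-- A subspace `s` of `q` is the intersection with `q` of a subspace of any dimension between
`dim s` and `dim s` plus the codimension of `q`. -/
theorem exists_inf_eq_finrank_eq [FiniteDimensional k V] {q s : Submodule k V} (hs : s ≤ q)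
    {n : ℕ} (hn : finrank k s ≤ n) (hn' : n + finrank k q ≤ finrank k s + finrank k V) :
    ∃ u : Submodule k V, u ⊓ q = s ∧ finrank k u = n := by
  obtain ⟨c, hc⟩ := q.exists_isCompl
  have hdim := finrank_add_eq_of_isCompl hc
  obtain ⟨t, ht, htn⟩ := c.exists_le_finrank_eq (n := n - finrank k s) (by omega)
  have htq : Disjoint t q := (hc.disjoint.mono_right ht).symm
  refine ⟨s ⊔ t, ?_, ?_⟩
  · rw [sup_inf_assoc_of_le t hs, htq.eq_bot, sup_bot_eq]
  · rw [finrank_sup_of_disjoint (htq.symm.mono_left hs)]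
    omega

end Submodule

namespace LinearMap

variable {k V W : Type*} [Field k] [AddCommGroup V] [Module k V] [AddCommGroup W] [Module k W]

theorem finrank_range_restrict_add [FiniteDimensional k V] (f : V →ₗ[k] W)
    {p : Submodule k V} {q : Submodule k W} (h : ∀ x ∈ p, f x ∈ q) :
    finrank k (range (f.restrict h)) + finrank k ↥(p ⊓ ker f) = finrank k p := by
  rw [← Submodule.finrank_map_add_finrank_ker_inf f p, inf_comm,
    ← Submodule.finrank_map_subtype_eq q (range (f.restrict h)), ← range_comp,
    subtype_comp_restrict, range_domRestrict]

theorem finrank_range_mapQ_add [FiniteDimensional k W] (f : V →ₗ[k] W)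
    {p : Submodule k V} {q : Submodule k W} (h : p ≤ q.comap f) :
    finrank k (range (p.mapQ q f h)) + finrank k ↥(q ⊓ range f) = finrank k (range f) := by
  rw [← Submodule.finrank_map_add_finrank_ker_inf q.mkQ (range f), Submodule.ker_mkQ,
    Submodule.range_mapQ]

end LinearMap

/-- For a linear map `f : V → W` of rank `r` between spaces of dimensions
`d₁`, `d₂`, and `e₁ ≤ d₁`, `e₂ ≤ d₂`, `r′`, `r″`, there exist subspaces `U₁ ⊆ V`,
`U₂ ⊆ W` with `dim U₁ = e₁`, `dim U₂ = e₂`, `f(U₁) ⊆ U₂`, such that the restriction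
`f|_{U₁} : U₁ → U₂` has rank `r′` and the induced map `V/U₁ → W/U₂` has rank `r″`, if and
only if `max(0, r + e₁ - d₁) ≤ r′ ≤ e₁`, `max(0, r - e₂) ≤ r″ ≤ d₂ - e₂` and
`r′ + r″ ≤ r` (subtraction of natural numbers being truncated). -/
theorem quiverGrassmannian_A2_stratum_nonempty_iff
    {k V W : Type*} [Field k]
    [AddCommGroup V] [Module k V] [AddCommGroup W] [Module k W]
    [FiniteDimensional k V] [FiniteDimensional k W]
    {d₁ d₂ e₁ e₂ r r' r'' : ℕ}
    (hd₁ : finrank k V = d₁) (hd₂ : finrank k W = d₂)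
    (f : V →ₗ[k] W) (hr : finrank k (LinearMap.range f) = r)
    (he₁ : e₁ ≤ d₁) (he₂ : e₂ ≤ d₂) :
    (∃ (U₁ : Submodule k V) (U₂ : Submodule k W) (hU : ∀ x ∈ U₁, f x ∈ U₂),
      finrank k U₁ = e₁ ∧ finrank k U₂ = e₂ ∧
      finrank k (LinearMap.range (f.restrict hU)) = r' ∧
      finrank k (LinearMap.range (Submodule.mapQ U₁ U₂ f (fun x hx => hU x hx))) = r'') ↔
    (r + e₁ - d₁ ≤ r' ∧ r' ≤ e₁ ∧ r - e₂ ≤ r'' ∧ r'' ≤ d₂ - e₂ ∧ r' + r'' ≤ r) := by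
  have hker := f.finrank_range_add_finrank_ker
  constructor
  · rintro ⟨U₁, U₂, hU, h₁, h₂, h', h''⟩
    have hres := f.finrank_range_restrict_add hU
    have hquo := f.finrank_range_mapQ_add (p := U₁) (q := U₂) hU
    have hmap : finrank k (U₁.map f) = r' := by
      have := Submodule.finrank_map_add_finrank_ker_inf f U₁
      rw [inf_comm] at this
      omega
    have hle₁ := Submodule.finrank_mono (inf_le_right : U₁ ⊓ LinearMap.ker f ≤ _)
    have hle₂ := Submodule.finrank_mono (inf_le_left : U₂ ⊓ LinearMap.range f ≤ _)
    have hle₃ := Submodule.finrank_mono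
      (le_inf (Submodule.map_le_iff_le_comap.2 hU) LinearMap.map_le_range :
        U₁.map f ≤ U₂ ⊓ LinearMap.range f)
    have hle₄ := Submodule.finrank_le (LinearMap.range (U₁.mapQ U₂ f hU))
    have hU₂ := U₂.finrank_quotient_add_finrank
    omega
  · rintro ⟨h₁, h₂, h₃, h₄, h₅⟩
    obtain ⟨s, hs, hsn⟩ := (LinearMap.ker f).exists_le_finrank_eq (n := e₁ - r') (by omega)
    obtain ⟨U₁, hU₁, hn₁⟩ :=
      Submodule.exists_inf_eq_finrank_eq hs (n := e₁) (by omega) (by omega)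
    have hmap : finrank k (U₁.map f) = r' := by
      have := Submodule.finrank_map_add_finrank_ker_inf f U₁
      rw [inf_comm, hU₁] at this
      omega
    obtain ⟨t, hUt, ht, htn⟩ := Submodule.exists_between_finrank_eq_s14
      (LinearMap.map_le_range : U₁.map f ≤ LinearMap.range f) (n := r - r'')
      (by omega) (by omega)
    obtain ⟨U₂, hU₂, hn₂⟩ :=
      Submodule.exists_inf_eq_finrank_eq ht (n := e₂) (by omega) (by omega)
    have hU : ∀ x ∈ U₁, f x ∈ U₂ :=
      Submodule.map_le_iff_le_comap.1 (hUt.trans (hU₂ ▸ inf_le_left))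
    have hres := f.finrank_range_restrict_add hU
    have hquo := f.finrank_range_mapQ_add (p := U₁) (q := U₂) hU
    rw [hU₁] at hres
    rw [hU₂] at hquo
    exact ⟨U₁, U₂, hU, hn₁, hn₂, by omega, by omega⟩
end

section
/- Let k be a field, let V and W be finite-dimensional k-vector spaces, and let f : V → W be a k-linear map. Let (U₁, U₂) and (U₁′, U₂′) be pairs of subspaces U₁, U₁′ ⊆ V and U₂, U₂′ ⊆ W with f(U₁) ⊆ U₂ and f(U₁′) ⊆ U₂′. Assume dim U₁ = dim U₁′, dim U₂ = dim U₂′, that the restrictions f|_{U₁} : U₁ → U₂ and f|_{U₁′} : U₁′ → U₂′ have equal rank, and that the induced maps f̄ : V/U₁ → W/U₂ and f̄′ : V/U₁′ → W/U₂′ have equal rank. Then there exist linear automorphisms g₁ of V and g₂ of W with g₂ ∘ f = f ∘ g₁, g₁(U₁) = U₁′ and g₂(U₂) = U₂′. -/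
open Module

/-- Linear equivalences between the summands of two direct sum decompositions glue. -/
theorem LinearEquiv.exists_glue_of_isCompl {k V V' : Type*} [Field k]
    [AddCommGroup V] [Module k V] [AddCommGroup V'] [Module k V']
    {p q : Submodule k V} {p' q' : Submodule k V'} (h : IsCompl p q) (h' : IsCompl p' q')
    (φ : p ≃ₗ[k] p') (ψ : q ≃ₗ[k] q') :
    ∃ e : V ≃ₗ[k] V', (∀ x : p, e x = φ x) ∧ ∀ x : q, e x = ψ x := by
  refine ⟨(Submodule.prodEquivOfIsCompl p q h).symm ≪≫ₗ φ.prodCongr ψ ≪≫ₗ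
    Submodule.prodEquivOfIsCompl p' q' h', fun x => ?_, fun x => ?_⟩
  · simp
  · simp

/-- A linear map sending `p` into `p'` by an equivalence sends `p` onto `p'`. -/
theorem Submodule.map_eq_of_forall_coe_eq {k V V' : Type*} [Field k]
    [AddCommGroup V] [Module k V] [AddCommGroup V'] [Module k V']
    {p : Submodule k V} {p' : Submodule k V'} (e : V →ₗ[k] V') (φ : p ≃ₗ[k] p')
    (h : ∀ x : p, e x = φ x) : p.map e = p' := by
  ext y
  constructor
  · rintro ⟨x, hx, rfl⟩
    rw [h ⟨x, hx⟩]
    exact (φ ⟨x, hx⟩).2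
  · intro hy
    exact ⟨φ.symm ⟨y, hy⟩, (φ.symm ⟨y, hy⟩).2, by simp [h]⟩

/-- Subspaces of equal dimension in spaces of equal dimension correspond under an equivalence. -/
theorem LinearEquiv.exists_map_eq_of_finrank_eq {k V V' : Type*} [Field k]
    [AddCommGroup V] [Module k V] [AddCommGroup V'] [Module k V']
    [FiniteDimensional k V] [FiniteDimensional k V']
    {p : Submodule k V} {p' : Submodule k V'} (hV : finrank k V = finrank k V')
    (hp : finrank k p = finrank k p') :
    ∃ e : V ≃ₗ[k] V', p.map (e : V →ₗ[k] V') = p' := by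
  obtain ⟨q, hq⟩ := p.exists_isCompl
  obtain ⟨q', hq'⟩ := p'.exists_isCompl
  have h := Submodule.finrank_add_eq_of_isCompl hq
  have h' := Submodule.finrank_add_eq_of_isCompl hq'
  obtain ⟨e, he, -⟩ := LinearEquiv.exists_glue_of_isCompl hq hq'
    (LinearEquiv.ofFinrankEq p p' hp) (LinearEquiv.ofFinrankEq q q' (by omega))
  exact ⟨e, Submodule.map_eq_of_forall_coe_eq _ _ he⟩

/-- A subspace `A` splits as `A ⊓ B` and a subspace of some complement of `B`. -/
theorem Submodule.exists_isCompl_and_inf_sup_eq {k V : Type*} [Field k]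
    [AddCommGroup V] [Module k V] (A B : Submodule k V) :
    ∃ C Q : Submodule k V, C ≤ Q ∧ IsCompl B Q ∧ Disjoint (A ⊓ B) C ∧ A ⊓ B ⊔ C = A := by
  obtain ⟨C, hd, hC⟩ := (A ⊓ B).exists_isCompl
  have hsup : A ⊓ B ⊔ A ⊓ C = A := by
    rw [inf_comm A C, ← sup_inf_assoc_of_le C (inf_le_left : A ⊓ B ≤ A), hC.eq_top, top_inf_eq]
  have hdis : Disjoint B (A ⊓ C) := by
    rw [disjoint_iff_inf_le, ← hd.eq_bot]
    exact le_inf (le_inf (inf_le_right.trans inf_le_left) inf_le_left)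
      (inf_le_right.trans inf_le_right)
  obtain ⟨Q, hQ, hBQ⟩ := hdis.symm.exists_isCompl
  exact ⟨A ⊓ C, Q, hQ, hBQ.symm, hdis.mono_left inf_le_right, hsup⟩

/-- Subspaces `A`, `A'` of equal dimension with the same intersection with `B` are related by an
automorphism fixing `B` pointwise. -/
theorem LinearEquiv.exists_map_eq_and_forall_mem_eq_self {k V : Type*} [Field k]
    [AddCommGroup V] [Module k V] [FiniteDimensional k V] {A A' B : Submodule k V}
    (hA : finrank k A = finrank k A') (hAB : A ⊓ B = A' ⊓ B) :
    ∃ e : V ≃ₗ[k] V, (∀ x ∈ B, e x = x) ∧ A.map (e : V →ₗ[k] V) = A' := by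
  obtain ⟨C, Q, hCQ, hBQ, hd, hC⟩ := A.exists_isCompl_and_inf_sup_eq B
  obtain ⟨C', Q', hCQ', hBQ', hd', hC'⟩ := A'.exists_isCompl_and_inf_sup_eq B
  have hQ := Submodule.finrank_add_eq_of_isCompl hBQ
  have hQ' := Submodule.finrank_add_eq_of_isCompl hBQ'
  have h := Submodule.finrank_sup_add_finrank_inf_eq (A ⊓ B) C
  have h' := Submodule.finrank_sup_add_finrank_inf_eq (A' ⊓ B) C'
  rw [hC, hd.eq_bot, finrank_bot, hAB] at h
  rw [hC', hd'.eq_bot, finrank_bot] at h'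
  obtain ⟨ψ, hψ⟩ := LinearEquiv.exists_map_eq_of_finrank_eq
    (p := C.comap Q.subtype) (p' := C'.comap Q'.subtype) (by omega)
    (by
      rw [(Submodule.comapSubtypeEquivOfLe hCQ).finrank_eq,
        (Submodule.comapSubtypeEquivOfLe hCQ').finrank_eq]
      omega)
  obtain ⟨e, heB, heQ⟩ := LinearEquiv.exists_glue_of_isCompl hBQ hBQ' (LinearEquiv.refl k B) ψ
  have heB' : ∀ x ∈ B, e x = x := fun x hx => heB ⟨x, hx⟩
  have heC : C.map (e : V →ₗ[k] V) = C' := by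
    have hcomp : (e : V →ₗ[k] V) ∘ₗ Q.subtype = Q'.subtype ∘ₗ (ψ : Q →ₗ[k] Q') :=
      LinearMap.ext heQ
    calc C.map (e : V →ₗ[k] V)
        = ((C.comap Q.subtype).map Q.subtype).map (e : V →ₗ[k] V) := by
          rw [Submodule.map_comap_subtype, inf_eq_right.2 hCQ]
      _ = C' := by
          rw [← Submodule.map_comp, hcomp, Submodule.map_comp, hψ,
            Submodule.map_comap_subtype, inf_eq_right.2 hCQ']
  refine ⟨e, heB', ?_⟩
  have hfix : (A ⊓ B).map (e : V →ₗ[k] V) = A ⊓ B :=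
    Submodule.map_eq_of_forall_coe_eq _ (LinearEquiv.refl k _) fun x => heB' x x.2.2
  rw [← hC, Submodule.map_sup, hfix, heC, hAB, hC']

/-- An automorphism matching `A ⊓ B` with `A' ⊓ B'` and `B` with `B'` can be modified away from
`B` so that it maps `A` onto `A'`, provided that these have the same dimension. -/
theorem LinearEquiv.exists_map_eq_and_eqOn {k V : Type*} [Field k]
    [AddCommGroup V] [Module k V] [FiniteDimensional k V] {A A' B B' : Submodule k V}
    (θ : V ≃ₗ[k] V) (hA : finrank k A = finrank k A') (hB : B.map (θ : V →ₗ[k] V) = B')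
    (hAB : (A ⊓ B).map (θ : V →ₗ[k] V) = A' ⊓ B') :
    ∃ e : V ≃ₗ[k] V, (∀ x ∈ B, e x = θ x) ∧ A.map (e : V →ₗ[k] V) = A' := by
  have hθ : (A.map (θ : V →ₗ[k] V)) ⊓ B' = A' ⊓ B' := by
    rw [← hAB, ← hB, Submodule.map_inf _ θ.injective]
  obtain ⟨e, he, heA⟩ := LinearEquiv.exists_map_eq_and_forall_mem_eq_self
    ((LinearEquiv.finrank_map_eq θ A).trans hA) hθ
  refine ⟨θ ≪≫ₗ e, fun x hx => he _ (hB ▸ Submodule.mem_map_of_mem hx), ?_⟩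
  rw [LinearEquiv.coe_trans, Submodule.map_comp, heA]

/-- An automorphism extends to one matching `A` with `A'` if it matches subspaces `B ≤ A` and
`B' ≤ A'`, after a modification away from `B`. -/
theorem LinearEquiv.exists_map_eq_and_eqOn_of_le {k V : Type*} [Field k]
    [AddCommGroup V] [Module k V] [FiniteDimensional k V] {A A' B B' : Submodule k V}
    (θ : V ≃ₗ[k] V) (hA : finrank k A = finrank k A') (hB : B.map (θ : V →ₗ[k] V) = B')
    (hBA : B ≤ A) (hBA' : B' ≤ A') :
    ∃ e : V ≃ₗ[k] V, (∀ x ∈ B, e x = θ x) ∧ A.map (e : V →ₗ[k] V) = A' :=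
  LinearEquiv.exists_map_eq_and_eqOn θ hA hB
    (by rw [inf_eq_right.2 hBA, inf_eq_right.2 hBA', hB])

theorem Submodule.map_congr_of_forall_mem {k V : Type*} [Field k]
    [AddCommGroup V] [Module k V] {B : Submodule k V} {e θ : V →ₗ[k] V}
    (h : ∀ x ∈ B, e x = θ x) : B.map e = B.map θ :=
  SetLike.coe_injective (Set.image_congr h)

/-- An automorphism of the source preserving the kernel of `f` descends along `f` to an
automorphism of the target. -/
theorem LinearMap.exists_linearEquiv_comp_eq_comp {k V W : Type*} [Field k]
    [AddCommGroup V] [Module k V] [AddCommGroup W] [Module k W] (f : V →ₗ[k] W)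
    (g : V ≃ₗ[k] V) (hg : (LinearMap.ker f).map (g : V →ₗ[k] V) = LinearMap.ker f) :
    ∃ e : W ≃ₗ[k] W, ∀ v, e (f v) = f (g v) := by
  obtain ⟨T, hT⟩ := (LinearMap.range f).exists_isCompl
  obtain ⟨e, he, -⟩ := LinearEquiv.exists_glue_of_isCompl hT hT
    (f.quotKerEquivRange.symm ≪≫ₗ Submodule.Quotient.equiv _ _ g hg ≪≫ₗ f.quotKerEquivRange)
    (LinearEquiv.refl k T)
  refine ⟨e, fun v => (he ⟨f v, f.mem_range_self v⟩).trans ?_⟩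
  have hv : f.quotKerEquivRange.symm ⟨f v, f.mem_range_self v⟩ = Submodule.Quotient.mk v := by
    rw [LinearEquiv.symm_apply_eq]
    rfl
  rw [LinearEquiv.trans_apply, LinearEquiv.trans_apply, hv]
  rfl

theorem LinearMap.finrank_range_restrict_add_finrank_inf_ker {k V W : Type*} [Field k]
    [AddCommGroup V] [Module k V] [AddCommGroup W] [Module k W] [FiniteDimensional k V]
    (f : V →ₗ[k] W) {p : Submodule k V} {q : Submodule k W} (h : ∀ x ∈ p, f x ∈ q) :
    finrank k (LinearMap.range (f.restrict h)) + finrank k ↥(p ⊓ LinearMap.ker f) =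
      finrank k p := by
  have hker : (LinearMap.ker (f.restrict h)).map p.subtype = p ⊓ LinearMap.ker f := by
    rw [← Submodule.map_comap_subtype]
    congr 1
    ext x
    simp [LinearMap.restrict_apply, Subtype.ext_iff]
  rw [← hker, Submodule.finrank_map_subtype_eq, LinearMap.finrank_range_add_finrank_ker]

theorem Submodule.finrank_range_mapQ_add_finrank_comap {k V W : Type*} [Field k]
    [AddCommGroup V] [Module k V] [AddCommGroup W] [Module k W] [FiniteDimensional k V]
    (f : V →ₗ[k] W) {p : Submodule k V} {q : Submodule k W} (h : p ≤ q.comap f) :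
    finrank k (LinearMap.range (p.mapQ q f h)) + finrank k (q.comap f) = finrank k V := by
  have hr : LinearMap.range (p.mapQ q f h) = LinearMap.range (q.mkQ ∘ₗ f) := by
    rw [Submodule.range_mapQ, LinearMap.range_comp]
  have hk : q.comap f = LinearMap.ker (q.mkQ ∘ₗ f) := by
    rw [LinearMap.ker_comp, Submodule.ker_mkQ]
  rw [hr, hk, LinearMap.finrank_range_add_finrank_ker]

/-- Let `f : V → W` be a linear map of finite-dimensional vector spaces
and let `(U₁, U₂)`, `(U₁′, U₂′)` be pairs of subspaces with `f(U₁) ⊆ U₂`, `f(U₁′) ⊆ U₂′`,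
`dim U₁ = dim U₁′`, `dim U₂ = dim U₂′`, such that the restrictions `U₁ → U₂` and
`U₁′ → U₂′` of `f` have equal rank and the induced maps `V/U₁ → W/U₂` and
`V/U₁′ → W/U₂′` have equal rank. Then there are linear automorphisms `g₁` of `V` and
`g₂` of `W` with `g₂ ∘ f = f ∘ g₁`, `g₁(U₁) = U₁′` and `g₂(U₂) = U₂′`. -/
theorem quiverGrassmannian_A2_orbit_determined_by_ranks
    {k V W : Type*} [Field k]
    [AddCommGroup V] [Module k V] [AddCommGroup W] [Module k W]
    [FiniteDimensional k V] [FiniteDimensional k W]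
    (f : V →ₗ[k] W)
    (U₁ U₁' : Submodule k V) (U₂ U₂' : Submodule k W)
    (hU : ∀ x ∈ U₁, f x ∈ U₂) (hU' : ∀ x ∈ U₁', f x ∈ U₂')
    (hdim₁ : finrank k U₁ = finrank k U₁')
    (hdim₂ : finrank k U₂ = finrank k U₂')
    (hrank' : finrank k (LinearMap.range (f.restrict hU)) =
      finrank k (LinearMap.range (f.restrict hU')))
    (hrank'' : finrank k (LinearMap.range (Submodule.mapQ U₁ U₂ f (fun x hx => hU x hx))) =
      finrank k (LinearMap.range (Submodule.mapQ U₁' U₂' f (fun x hx => hU' x hx)))) :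
    ∃ (g₁ : V ≃ₗ[k] V) (g₂ : W ≃ₗ[k] W),
      (g₂ : W →ₗ[k] W) ∘ₗ f = f ∘ₗ (g₁ : V →ₗ[k] V) ∧
      U₁.map (g₁ : V →ₗ[k] V) = U₁' ∧
      U₂.map (g₂ : W →ₗ[k] W) = U₂' := by
  have hr := f.finrank_range_restrict_add_finrank_inf_ker hU
  have hr' := f.finrank_range_restrict_add_finrank_inf_ker hU'
  have hq := Submodule.finrank_range_mapQ_add_finrank_comap f (fun x hx => hU x hx : U₁ ≤ U₂.comap f)
  have hq' := Submodule.finrank_range_mapQ_add_finrank_comap f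
    (fun x hx => hU' x hx : U₁' ≤ U₂'.comap f)
  have hker : ∀ U : Submodule k W, LinearMap.ker f ≤ U.comap f := fun U =>
    Submodule.comap_mono bot_le
  obtain ⟨a, ha⟩ := LinearEquiv.exists_map_eq_of_finrank_eq (rfl : finrank k V = finrank k V)
    (by omega : finrank k ↥(U₁ ⊓ LinearMap.ker f) = finrank k ↥(U₁' ⊓ LinearMap.ker f))
  obtain ⟨b, hb, hbK⟩ := LinearEquiv.exists_map_eq_and_eqOn_of_le
    (A := LinearMap.ker f) (A' := LinearMap.ker f) a rfl ha inf_le_right inf_le_right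
  obtain ⟨c, hc, hcU⟩ := LinearEquiv.exists_map_eq_and_eqOn b hdim₁ hbK
    ((Submodule.map_congr_of_forall_mem hb).trans ha)
  have hcK : (LinearMap.ker f).map (c : V →ₗ[k] V) = LinearMap.ker f :=
    (Submodule.map_congr_of_forall_mem hc).trans hbK
  obtain ⟨g, hg, hgS⟩ := LinearEquiv.exists_map_eq_and_eqOn_of_le
    (A := U₂.comap f) (A' := U₂'.comap f) (B := U₁ ⊔ LinearMap.ker f)
    (B' := U₁' ⊔ LinearMap.ker f) c (by omega) (by rw [Submodule.map_sup, hcU, hcK])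
    (sup_le hU (hker U₂)) (sup_le hU' (hker U₂'))
  have hgU : U₁.map (g : V →ₗ[k] V) = U₁' :=
    (Submodule.map_congr_of_forall_mem fun x hx => hg x (Submodule.mem_sup_left hx)).trans hcU
  have hgK : (LinearMap.ker f).map (g : V →ₗ[k] V) = LinearMap.ker f :=
    (Submodule.map_congr_of_forall_mem fun x hx => hg x (Submodule.mem_sup_right hx)).trans hcK
  obtain ⟨d, hd⟩ := f.exists_linearEquiv_comp_eq_comp g hgK
  have hdf : (d : W →ₗ[k] W) ∘ₗ f = f ∘ₗ (g : V →ₗ[k] V) := LinearMap.ext hd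
  obtain ⟨e, he, heU⟩ := LinearEquiv.exists_map_eq_and_eqOn
    (B := LinearMap.range f) (B' := LinearMap.range f) d hdim₂
    (by rw [← LinearMap.range_comp, hdf, LinearMap.range_comp_of_range_eq_top _ g.range])
    (by
      rw [inf_comm, inf_comm U₂', ← Submodule.map_comap_eq, ← Submodule.map_comap_eq,
        ← Submodule.map_comp, hdf, Submodule.map_comp, hgS])
  exact ⟨g, e, LinearMap.ext fun v => (he _ ⟨v, rfl⟩).trans (hd v), hgU, heU⟩
end

section
/- Let k be a field, let V and W be finite-dimensional k-vector spaces with dim V = d₁ and dim W = d₂, and let f : V → W be a k-linear map. Let U₁ ⊆ V and U₂ ⊆ W be subspaces with dim U₁ = e₁, dim U₂ = e₂ and f(U₁) ⊆ U₂; let r′ be the rank of the restriction f|_{U₁} : U₁ → U₂ and r″ the rank of the induced map f̄ : V/U₁ → W/U₂. Let T be the k-vector space of pairs (φ, ψ) of linear maps φ : U₁ → V/U₁ and ψ : U₂ → W/U₂ satisfying f̄ ∘ φ = ψ ∘ f|_{U₁}. Then dim_k T = e₁(d₁ − e₁) + e₂(d₂ − e₂) − (d₂ − e₂)·r′ − e₁·r″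 + r′·r″. -/
open Module

/-- Given linear maps `a : X₁ → X₂` and `b : Y₁ → Y₂`, the linear map on pairs
`(φ, ψ) ↦ b ∘ φ - ψ ∘ a`; its kernel is the space of pairs `(φ, ψ)` with
`b ∘ φ = ψ ∘ a`. -/
def commSquareDefect {k : Type*} [Field k] {X₁ X₂ Y₁ Y₂ : Type*}
    [AddCommGroup X₁] [Module k X₁] [AddCommGroup X₂] [Module k X₂]
    [AddCommGroup Y₁] [Module k Y₁] [AddCommGroup Y₂] [Module k Y₂]
    (a : X₁ →ₗ[k] X₂) (b : Y₁ →ₗ[k] Y₂) :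
    ((X₁ →ₗ[k] Y₁) × (X₂ →ₗ[k] Y₂)) →ₗ[k] (X₁ →ₗ[k] Y₂) where
  toFun p := b ∘ₗ p.1 - p.2 ∘ₗ a
  map_add' p q := by ext; simp; abel
  map_smul' c p := by ext; simp [smul_sub]

section

variable {k : Type*} [Field k] {X₁ X₂ Y₁ Y₂ : Type*}
  [AddCommGroup X₁] [Module k X₁] [AddCommGroup X₂] [Module k X₂]
  [AddCommGroup Y₁] [Module k Y₁] [AddCommGroup Y₂] [Module k Y₂]

/-- Every linear map over a field has a generalized inverse. -/
theorem LinearMap.exists_comp_comp_eq_self (a : X₁ →ₗ[k] X₂) :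
    ∃ s : X₂ →ₗ[k] X₁, ∀ x, a (s (a x)) = a x := by
  obtain ⟨σ, hσ⟩ := a.rangeRestrict.exists_rightInverse_of_surjective a.range_rangeRestrict
  obtain ⟨s, hs⟩ := LinearMap.exists_extend σ
  refine ⟨s, fun x => ?_⟩
  have h₁ : s (a x) = σ (a.rangeRestrict x) := LinearMap.congr_fun hs (a.rangeRestrict x)
  have h₂ := congrArg Subtype.val (LinearMap.congr_fun hσ (a.rangeRestrict x))
  rw [h₁]
  exact h₂

/-- The map sending `g : X₁ → Y₂` to the induced map `ker a → coker b`. -/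
def kerToCoker (a : X₁ →ₗ[k] X₂) (b : Y₁ →ₗ[k] Y₂) :
    (X₁ →ₗ[k] Y₂) →ₗ[k] (LinearMap.ker a →ₗ[k] Y₂ ⧸ LinearMap.range b) where
  toFun g := (LinearMap.range b).mkQ ∘ₗ g ∘ₗ (LinearMap.ker a).subtype
  map_add' g h := by ext; simp
  map_smul' c g := by ext; simp

theorem kerToCoker_surjective (a : X₁ →ₗ[k] X₂) (b : Y₁ →ₗ[k] Y₂) :
    Function.Surjective (kerToCoker a b) := by
  intro h
  obtain ⟨h', hh'⟩ := LinearMap.exists_extend h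
  obtain ⟨t, ht⟩ := (LinearMap.range b).mkQ.exists_rightInverse_of_surjective
    (Submodule.range_mkQ _)
  refine ⟨t ∘ₗ h', ?_⟩
  change (LinearMap.range b).mkQ ∘ₗ (t ∘ₗ h') ∘ₗ (LinearMap.ker a).subtype = h
  rw [LinearMap.comp_assoc, hh', ← LinearMap.comp_assoc, ht, LinearMap.id_comp]

theorem range_commSquareDefect (a : X₁ →ₗ[k] X₂) (b : Y₁ →ₗ[k] Y₂) :
    LinearMap.range (commSquareDefect a b) = LinearMap.ker (kerToCoker a b) := by
  apply le_antisymm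
  · rintro _ ⟨p, rfl⟩
    refine LinearMap.mem_ker.2 (LinearMap.ext fun x => ?_)
    refine (Submodule.Quotient.mk_eq_zero _).2 ⟨p.1 x, ?_⟩
    simp [commSquareDefect]
  · intro g hg
    have hg' : ∀ x, a x = 0 → ∃ y, b y = g x := fun x hx =>
      (Submodule.Quotient.mk_eq_zero _).1
        (LinearMap.congr_fun (LinearMap.mem_ker.1 hg) (⟨x, hx⟩ : LinearMap.ker a))
    obtain ⟨s, hs⟩ := a.exists_comp_comp_eq_self
    obtain ⟨t, ht⟩ := b.exists_comp_comp_eq_self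
    refine ⟨(t ∘ₗ g ∘ₗ (LinearMap.id - s ∘ₗ a), -(g ∘ₗ s)), LinearMap.ext fun x => ?_⟩
    obtain ⟨y, hy⟩ := hg' (x - s (a x)) (by rw [map_sub, hs, sub_self])
    change b (t (g (x - s (a x)))) - -g (s (a x)) = g x
    rw [← hy, ht, hy, map_sub]
    abel

theorem finrank_ker_commSquareDefect [FiniteDimensional k X₁] [FiniteDimensional k X₂]
    [FiniteDimensional k Y₁] [FiniteDimensional k Y₂] (a : X₁ →ₗ[k] X₂) (b : Y₁ →ₗ[k] Y₂) :
    finrank k (LinearMap.ker (commSquareDefect a b)) + finrank k X₁ * finrank k Y₂ =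
      finrank k X₁ * finrank k Y₁ + finrank k X₂ * finrank k Y₂ +
        finrank k (LinearMap.ker a) * finrank k (Y₂ ⧸ LinearMap.range b) := by
  have h₁ := (commSquareDefect a b).finrank_range_add_finrank_ker
  have h₂ := (kerToCoker a b).finrank_range_add_finrank_ker
  rw [LinearMap.range_eq_top.2 (kerToCoker_surjective a b), finrank_top,
    finrank_linearMap, finrank_linearMap] at h₂
  rw [range_commSquareDefect, finrank_prod, finrank_linearMap, finrank_linearMap] at h₁
  omega

end

/-- Let `f : V → W` be linear with `dim V = d₁`, `dim W = d₂`, and let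
`U₁ ⊆ V`, `U₂ ⊆ W` be subspaces with `dim U₁ = e₁`, `dim U₂ = e₂`, `f(U₁) ⊆ U₂`; let `r′`
be the rank of the restriction `f|_{U₁} : U₁ → U₂` and `r″` the rank of the induced map
`f̄ : V/U₁ → W/U₂`. Then the space `T` of pairs `(φ, ψ)` of linear maps `φ : U₁ → V/U₁`,
`ψ : U₂ → W/U₂` with `f̄ ∘ φ = ψ ∘ f|_{U₁}` has dimension
`e₁(d₁ − e₁) + e₂(d₂ − e₂) − (d₂ − e₂)·r′ − e₁·r″ + r′·r″`. -/
theorem quiverGrassmannian_A2_tangent_space_dim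
    {k V W : Type*} [Field k]
    [AddCommGroup V] [Module k V] [AddCommGroup W] [Module k W]
    [FiniteDimensional k V] [FiniteDimensional k W]
    {d₁ d₂ e₁ e₂ r' r'' : ℕ}
    (hd₁ : finrank k V = d₁) (hd₂ : finrank k W = d₂)
    (f : V →ₗ[k] W)
    (U₁ : Submodule k V) (U₂ : Submodule k W) (hU : ∀ x ∈ U₁, f x ∈ U₂)
    (he₁ : finrank k U₁ = e₁) (he₂ : finrank k U₂ = e₂)
    (hr' : finrank k (LinearMap.range (f.restrict hU)) = r')
    (hr'' : finrank k
      (LinearMap.range (Submodule.mapQ U₁ U₂ f (fun x hx => hU x hx))) = r'') :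
    finrank k
      (LinearMap.ker (commSquareDefect (f.restrict hU)
        (Submodule.mapQ U₁ U₂ f (fun x hx => hU x hx)))) =
      e₁ * (d₁ - e₁) + e₂ * (d₂ - e₂) - (d₂ - e₂) * r' - e₁ * r'' + r' * r'' := by
  have key := finrank_ker_commSquareDefect (f.restrict hU)
    (Submodule.mapQ U₁ U₂ f (fun x hx => hU x hx))
  have ha := (f.restrict hU).finrank_range_add_finrank_ker
  have hb := (LinearMap.range
    (Submodule.mapQ U₁ U₂ f (fun x hx => hU x hx))).finrank_quotient_add_finrank
  have hr₁ := (LinearMap.range (f.restrict hU)).finrank_le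
  have hr₂ := (Submodule.mapQ U₁ U₂ f (fun x hx => hU x hx)).finrank_range_le
  have hn₁ : finrank k (V ⧸ U₁) = d₁ - e₁ := by
    have := U₁.finrank_quotient_add_finrank
    omega
  have hn₂ : finrank k (W ⧸ U₂) = d₂ - e₂ := by
    have := U₂.finrank_quotient_add_finrank
    omega
  rw [he₁, hr'] at ha
  rw [hn₂, hr''] at hb
  rw [hr', he₂] at hr₁
  rw [hr'', hn₁] at hr₂
  rw [he₁, he₂, hn₁, hn₂] at key
  have h₁ := Nat.mul_le_mul_left (d₂ - e₂) hr₁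
  have h₂ := Nat.mul_le_mul_left e₁ hr₂
  rw [mul_comm _ e₂] at h₁
  generalize d₁ - e₁ = n₁ at *
  generalize d₂ - e₂ = n₂ at *
  rw [Nat.sub_sub, ← Nat.sub_add_comm (by omega)]
  apply Nat.eq_sub_of_add_eq
  subst ha hb
  linarith
end
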